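/- No triangle-local probability distribution P on (Fin 2)³ has support exactly equal to {(0,1,1),(1,0,0),(1,1,0),(1,1,1)}. -/

import Mathlib

/-- `P` is a local probability distribution in the triangle network: the three
sources are finite independent hidden variables, processed by stochastic
response kernels at the three observers. -/
def IsTriangleLocal (P : Fin 2 → Fin 2 → Fin 2 → ℝ) : Prop :=
  ∃ (nα nβ nγ : ℕ)
    (pα : Fin nα → ℝ) (pβ : Fin nβ → ℝ) (pγ : Fin nγ → ℝ)
    (PA : Fin 2 → Fin nβ → Fin nγ → ℝ)
    (PB : Fin 2 → Fin nγ → Fin nα → ℝ)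
    (PC : Fin 2 → Fin nα → Fin nβ → ℝ),
    (∀ α, 0 ≤ pα α) ∧ (∑ α, pα α) = 1 ∧
    (∀ β, 0 ≤ pβ β) ∧ (∑ β, pβ β) = 1 ∧
    (∀ γ, 0 ≤ pγ γ) ∧ (∑ γ, pγ γ) = 1 ∧
    (∀ a β γ, 0 ≤ PA a β γ) ∧ (∀ β γ, (∑ a, PA a β γ) = 1) ∧
    (∀ b γ α, 0 ≤ PB b γ α) ∧ (∀ γ α, (∑ b, PB b γ α) = 1) ∧
    (∀ c α β, 0 ≤ PC c α β) ∧ (∀ α β, (∑ c, PC c α β) = 1) ∧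
    (∀ a b c, P a b c =
      ∑ α, ∑ β, ∑ γ, pα α * pβ β * pγ γ * PA a β γ * PB b γ α * PC c α β)

/-- A positive triple sum has a positive term. -/
theorem exists_pos_of_triple_sum_pos {ι κ μ : Type*} [Fintype ι] [Fintype κ] [Fintype μ]
    {f : ι → κ → μ → ℝ} (h : 0 < ∑ i, ∑ j, ∑ k, f i j k) : ∃ i j k, 0 < f i j k := by
  by_contra! hf
  exact h.not_ge (Finset.sum_nonpos fun i _ => Finset.sum_nonpos fun j _ =>
    Finset.sum_nonpos fun k _ => hf i j k)

/-- No triangle-local distribution has support exactly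
`{(0,1,1),(1,0,0),(1,1,0),(1,1,1)}`. -/
theorem no_triangle_local_P4 :
    ¬ ∃ P : Fin 2 → Fin 2 → Fin 2 → ℝ, IsTriangleLocal P ∧
      ∀ a b c : Fin 2, (0 < P a b c ↔
        ((a, b, c) = ((0 : Fin 2), (1 : Fin 2), (1 : Fin 2)) ∨
         (a, b, c) = ((1 : Fin 2), (0 : Fin 2), (0 : Fin 2)) ∨
         (a, b, c) = ((1 : Fin 2), (1 : Fin 2), (0 : Fin 2)) ∨
         (a, b, c) = ((1 : Fin 2), (1 : Fin 2), (1 : Fin 2)))) := by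
  rintro ⟨P, ⟨nα, nβ, nγ, pα, pβ, pγ, PA, PB, PC, hα, -, hβ, -, hγ, -, hA, hA1, hB, hB1,
    hC, hC1, hP⟩, hS⟩
  have term_nonneg : ∀ a b c α β γ,
      0 ≤ pα α * pβ β * pγ γ * PA a β γ * PB b γ α * PC c α β := fun a b c α β γ =>
    mul_nonneg (mul_nonneg (mul_nonneg (mul_nonneg (mul_nonneg (hα α) (hβ β)) (hγ γ))
      (hA a β γ)) (hB b γ α)) (hC c α β)
  have factors_pos : ∀ a b c, 0 < P a b c → ∃ α β γ,
      0 < pα α ∧ 0 < pβ β ∧ 0 < pγ γ ∧ 0 < PA a β γ ∧ 0 < PB b γ α := by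
    intro a b c h
    rw [hP] at h
    obtain ⟨α, β, γ, h⟩ := exists_pos_of_triple_sum_pos h
    have h₁ := pos_of_mul_pos_left h (hC c α β)
    have h₂ := pos_of_mul_pos_left h₁ (hB b γ α)
    have h₃ := pos_of_mul_pos_left h₂ (hA a β γ)
    have h₄ := pos_of_mul_pos_left h₃ (hγ γ)
    exact ⟨α, β, γ, pos_of_mul_pos_left h₄ (hβ β), pos_of_mul_pos_right h₄ (hα α),
      pos_of_mul_pos_right h₃ (mul_nonneg (hα α) (hβ β)), pos_of_mul_pos_right h₂ (by positivity),
      pos_of_mul_pos_right h₁ h₂.le⟩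
  have term_pos : ∀ a b c α β γ, 0 < pα α → 0 < pβ β → 0 < pγ γ → 0 < PA a β γ →
      0 < PB b γ α → 0 < PC c α β → 0 < P a b c := by
    intro a b c α β γ h₁ h₂ h₃ h₄ h₅ h₆
    rw [hP]
    exact Finset.sum_pos' (fun i _ => Finset.sum_nonneg fun j _ => Finset.sum_nonneg fun k _ =>
      term_nonneg a b c i j k) ⟨α, Finset.mem_univ _,
      Finset.sum_pos' (fun j _ => Finset.sum_nonneg fun k _ => term_nonneg a b c α j k)
        ⟨β, Finset.mem_univ _, Finset.sum_pos' (fun k _ => term_nonneg a b c α β k)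
          ⟨γ, Finset.mem_univ _, by positivity⟩⟩⟩
  have exists_pos : ∀ f : Fin 2 → ℝ, ∑ i, f i = 1 → ∃ i, 0 < f i := by
    intro f hf
    by_contra! h
    linarith [Finset.sum_nonpos fun i (_ : i ∈ Finset.univ) => h i]
  obtain ⟨-, β, γ₀, -, hβ₀, hγ₀, hA₀, -⟩ := factors_pos 0 1 1 ((hS 0 1 1).2 (by simp))
  obtain ⟨α, -, γ₁, hα₁, -, hγ₁, -, hB₀⟩ := factors_pos 1 0 0 ((hS 1 0 0).2 (by simp))
  -- The output `c` at `(α, β)` is compatible both with `a = 0` and with `b = 0`.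
  obtain ⟨c, hc⟩ := exists_pos (fun c => PC c α β) (hC1 α β)
  obtain ⟨b, hb⟩ := exists_pos (fun b => PB b γ₀ α) (hB1 γ₀ α)
  obtain ⟨a, ha⟩ := exists_pos (fun a => PA a β γ₁) (hA1 β γ₁)
  have h₀ := (hS 0 b c).1 (term_pos 0 b c α β γ₀ hα₁ hβ₀ hγ₀ hA₀ hb hc)
  have h₁ := (hS a 0 c).1 (term_pos a 0 c α β γ₁ hα₁ hβ₀ hγ₁ ha hB₀ hc)
  simp at h₀ h₁
  omega
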